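/- arXiv:1612.08429 — 5 statements merged into one kernel-verified Lean document; each statement's English description precedes it below -/
import Mathlib

section
/- Let μ : D → U be an acyclic partial matching on a finite graded poset P. Then there exists an injective function f : P → ℤ such that for every covering pair e ⋖ e' in P one has f(e) ≥ f(e') if and only if e ∈ D and e' = μ(e). (Consequently f is a discrete Morse function — for every e ∈ P each of the sets {e' : e ⋖ e', f(e) ≥ f(e')} and {e' : e' ⋖ e, f(e') ≥ f(e)} has at most one element — whose associated partial matching is exactly μ.) -/
/-- A partial matching on a poset `P`: a bijection `μ : D → U` between disjoint
subsets `D, U ⊆ P` such that `d ⋖ μ d` for every `d ∈ D`. -/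
structure PartialMatching (P : Type) [PartialOrder P] where
  D : Set P
  U : Set P
  m : P → P
  minv : P → P
  disj : Disjoint D U
  m_mem : ∀ d ∈ D, m d ∈ U
  minv_mem : ∀ u ∈ U, minv u ∈ D
  left_inv : ∀ d ∈ D, minv (m d) = d
  right_inv : ∀ u ∈ U, m (minv u) = u
  cov : ∀ d ∈ D, d ⋖ m d

namespace PartialMatching

variable {P : Type} [PartialOrder P]

/-- The set of critical elements. -/
def Cr (M : PartialMatching P) : Set P := (M.D ∪ M.U)ᶜ

/-- A partial matching is acyclic if every Forman path is a gradient path. -/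
def IsAcyclic (M : PartialMatching P) : Prop :=
  ∀ (n : ℕ) (d : ℕ → P), 1 ≤ n →
    (∀ i j, i < n → j < n → d i = d j → i = j) →
    (∀ i, i < n → d i ∈ M.D) →
    (∀ i, i + 1 < n → d (i + 1) ⋖ M.m (d i)) →
    n = 1 ∨ ¬ d 0 ⋖ M.m (d (n - 1))

/-- A faithful discrete Morse function adapted to `M`. -/
def Faithful (M : PartialMatching P) (f : P → ℤ) : Prop :=
  Function.Injective f ∧
  (∀ d ∈ M.D, f (M.m d) < f d) ∧
  ∀ e e' : P, e < e' → ¬(e ∈ M.D ∧ e' = M.m e) → f e < f e'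

end PartialMatching

/-- The data of a flow path `(e₁,u₁,…,e_n,u_n;c)`: the list of pairs
`steps = [(e₁,u₁),…,(e_n,u_n)]` and the final (critical) cell `c`. -/
structure FlowPath (P : Type) where
  steps : List (P × P)
  c : P

namespace FlowPath

variable {P : Type} [PartialOrder P]

/-- The length `ℓ(γ) = n` of a flow path. -/
def len (γ : FlowPath P) : ℕ := γ.steps.length

/-- `eAt γ i = e_{i+1}` (0-based); by convention `eAt γ i = c` for `i ≥ len γ`. -/
def eAt (γ : FlowPath P) (i : ℕ) : P := (γ.steps.map Prod.fst).getD i γ.c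

/-- `uAt γ i = u_{i+1}` (0-based). -/
def uAt (γ : FlowPath P) (i : ℕ) : P := (γ.steps.map Prod.snd).getD i γ.c

/-- The initial cell `ι(γ)` (equal to `c` when `len γ = 0`). -/
def init (γ : FlowPath P) : P := γ.eAt 0

/-- The target `τ(γ) = c`. -/
def tgt (γ : FlowPath P) : P := γ.c

/-- `γ` is a genuine flow path with respect to the matching `M`. -/
def Valid (M : PartialMatching P) (γ : FlowPath P) : Prop :=
  γ.c ∈ M.Cr ∧
  ∀ i, i < γ.len →
    γ.uAt i ∈ M.U ∧
    (γ.eAt i = γ.uAt i ∨ γ.eAt i = M.minv (γ.uAt i)) ∧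
    γ.eAt (i + 1) < γ.uAt i ∧
    γ.eAt (i + 1) ≠ M.minv (γ.uAt i)

/-- `φ : {0,…,k} → {0,…,ℓ(γ')+1}` is an embedding function for `γ ⪯ γ'`.
Indices of cells are 1-based as in the paper, so the paper's `e_j` is `eAt γ (j-1)`. -/
def IsEmbed (γ γ' : FlowPath P) (k : ℕ) (φ : ℕ → ℕ) : Prop :=
  1 ≤ k ∧ k ≤ γ.len + 1 ∧
  (∀ i j, i < j → j ≤ k → φ i < φ j) ∧
  φ 0 = 0 ∧ φ k = γ'.len + 1 ∧
  (∀ j, 1 ≤ j → j < k → γ.uAt (j - 1) = γ'.uAt (φ j - 1)) ∧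
  (∀ j p, 1 ≤ j → j ≤ k → φ (j - 1) < p → p ≤ φ j → γ.eAt (j - 1) ≤ γ'.eAt (p - 1))

/-- The subpath relation `γ ⪯ γ'`. -/
def Subpath (γ γ' : FlowPath P) : Prop := ∃ k φ, IsEmbed γ γ' k φ

/-- `γ` is reducible at `i` (0-based; the paper's index is `i+1`). -/
def ReducibleAt (M : PartialMatching P) (γ : FlowPath P) (i : ℕ) : Prop :=
  i < γ.len ∧ γ.eAt (i + 1) < M.minv (γ.uAt i)

/-- `γ` is reduced: it is reducible at no index. -/
def Reduced (M : PartialMatching P) (γ : FlowPath P) : Prop :=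
  ∀ i, ¬ ReducibleAt M γ i

/-- Concatenation `γ * δ` of flow paths. -/
def concat (γ δ : FlowPath P) : FlowPath P := ⟨γ.steps ++ δ.steps, δ.c⟩

/-- The collapse `τ(γ ⪯ γ')`: the tail of `γ` starting at its (1-based) `k`-th cell. -/
def collapse (γ : FlowPath P) (k : ℕ) : FlowPath P := ⟨γ.steps.drop (k - 1), γ.c⟩

/-- `rγ` is the reduction of `γ`: the greatest reduced flow path `⪯ γ`. -/
def IsReduction (M : PartialMatching P) (γ rγ : FlowPath P) : Prop :=
  Valid M rγ ∧ Reduced M rγ ∧ Subpath rγ γ ∧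
  ∀ δ, Valid M δ → Reduced M δ → Subpath δ γ → Subpath δ rγ

end FlowPath

/-- A nonempty chain of relations, listed backwards as a sequence. -/
theorem exists_seq_of_transGen {α : Type*} {r : α → α → Prop} {a b : α}
    (h : Relation.TransGen r a b) :
    ∃ (n : ℕ) (d : ℕ → α), 1 ≤ n ∧ d 0 = b ∧ d n = a ∧ ∀ i < n, r (d (i + 1)) (d i) := by
  induction h with
  | @single b h =>
    refine ⟨1, fun i => if i = 0 then b else a, le_rfl, by simp, by simp, fun i hi => ?_⟩
    obtain rfl : i = 0 := by omega
    simpa using h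
  | @tail b c _ hbc ih =>
    obtain ⟨n, d, hn, h0, hd, hr⟩ := ih
    refine ⟨n + 1, fun i => Nat.casesOn i c d, by omega, rfl, hd, fun i hi => ?_⟩
    cases i with
    | zero => simpa [h0] using hbc
    | succ i => exact hr i (by omega)

/-- A cyclic chain of relations contains a cycle without repetitions. -/
theorem exists_injective_cycle_of_transGen {α : Type*} {r : α → α → Prop} {a : α}
    (h : Relation.TransGen r a a) :
    ∃ (n : ℕ) (d : ℕ → α), 1 ≤ n ∧ d n = d 0 ∧ (∀ i < n, r (d (i + 1)) (d i)) ∧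
      ∀ i j, i < n → j < n → d i = d j → i = j := by
  classical
  have hex : ∃ n, ∃ d : ℕ → α, 1 ≤ n ∧ d n = d 0 ∧ ∀ i < n, r (d (i + 1)) (d i) := by
    obtain ⟨n, d, hn, h0, hd, hr⟩ := exists_seq_of_transGen h
    exact ⟨n, d, hn, hd.trans h0.symm, hr⟩
  obtain ⟨d, hn, hd, hr⟩ := Nat.find_spec hex
  have key : ∀ i j, i < j → j < Nat.find hex → d i ≠ d j := fun i j hij hj heq =>
    Nat.find_min hex (show j - i < Nat.find hex by omega)
      ⟨fun k => d (i + k), by omega, by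
        show d (i + (j - i)) = d (i + 0)
        rw [Nat.add_sub_cancel' hij.le, Nat.add_zero, heq],
        fun k hk => hr (i + k) (by omega)⟩
  refine ⟨_, d, hn, hd, hr, fun i j hi hj heq => ?_⟩
  rcases lt_trichotomy i j with hlt | rfl | hlt
  · exact (key i j hlt hj heq).elim
  · rfl
  · exact (key j i hlt hi heq.symm).elim

/-- A relation on a finite type whose transitive closure is irreflexive has a bounded height. -/
theorem exists_height_of_transGen_irrefl {α : Type*} [Fintype α] {r : α → α → Prop}
    (hirr : ∀ a, ¬ Relation.TransGen r a a) :
    ∃ h : α → ℕ, (∀ a, h a ≤ Fintype.card α) ∧ ∀ a b, r a b → h a < h b := by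
  classical
  refine ⟨fun a => (Finset.univ.filter fun x => Relation.TransGen r x a).card,
    fun a => Finset.card_le_univ _, fun a b hab => Finset.card_lt_card ?_⟩
  rw [Finset.ssubset_iff_of_subset fun x hx => by
    simp only [Finset.mem_filter, Finset.mem_univ, true_and] at hx ⊢
    exact hx.tail hab]
  exact ⟨a, by simpa using Relation.TransGen.single hab, by simpa using hirr a⟩

/-- Ties in a natural-number-valued function on a finite type can be broken injectively. -/
theorem exists_injective_int_refinement {α : Type*} [Fintype α] (g : α → ℕ) :
    ∃ f : α → ℤ, Function.Injective f ∧ ∀ a b, g a < g b → f a < f b := by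
  let e := Fintype.equivFin α
  have hlt : ∀ a b, g a < g b →
      g a * Fintype.card α + (e a : ℕ) < g b * Fintype.card α + (e b : ℕ) := fun a b hab => by
    have := (e a).isLt
    nlinarith [Nat.mul_le_mul_right (Fintype.card α) (Nat.succ_le_of_lt hab)]
  refine ⟨fun a => ((g a * Fintype.card α + (e a : ℕ) : ℕ) : ℤ), fun a b hab => ?_,
    fun a b hab => Int.ofNat_lt.mpr (hlt a b hab)⟩
  have hab' : g a * Fintype.card α + (e a : ℕ) = g b * Fintype.card α + (e b : ℕ) :=
    Int.ofNat_inj.mp hab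
  rcases lt_trichotomy (g a) (g b) with h | h | h
  · exact absurd hab' (hlt a b h).ne
  · rw [h] at hab'
    exact e.injective (Fin.ext (by omega))
  · exact absurd hab' (hlt b a h).ne'

namespace PartialMatching

variable {P : Type} [PartialOrder P]

/-- One step `d → d'` of a Forman path with `d' ≠ d`. -/
def FormanStep (M : PartialMatching P) (d' d : P) : Prop :=
  d' ∈ M.D ∧ d ∈ M.D ∧ d' ⋖ M.m d ∧ d' ≠ d

theorem IsAcyclic.transGen_formanStep_irrefl {M : PartialMatching P} (hM : M.IsAcyclic) (a : P) :
    ¬ Relation.TransGen M.FormanStep a a := by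
  intro h
  obtain ⟨n, d, hn, hd, hr, hinj⟩ := exists_injective_cycle_of_transGen h
  rcases hM n d hn hinj (fun i hi => (hr i hi).2.1) (fun i hi => (hr i (by omega)).2.2.1) with
    rfl | h1
  · exact (hr 0 one_pos).2.2.2 hd
  · have := (hr (n - 1) (by omega)).2.2.1
    rw [Nat.sub_add_cancel hn, hd] at this
    exact h1 this

open Classical in
/-- The lexicographic potential built from the dimension of a cell, the height of the
matched pair containing it, and its position inside that pair. -/
noncomputable def potential (M : PartialMatching P) (rk h : P → ℕ) (N : ℕ) (x : P) : ℕ :=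
  if x ∈ M.D then (2 * rk x + 1) * N + (2 * h x + 1)
  else if x ∈ M.U then (2 * rk (M.minv x) + 1) * N + 2 * h (M.minv x)
  else 2 * rk x * N

variable {M : PartialMatching P} {rk h : P → ℕ} {N : ℕ}

theorem potential_of_mem_D {x : P} (hx : x ∈ M.D) :
    M.potential rk h N x = (2 * rk x + 1) * N + (2 * h x + 1) := if_pos hx

theorem potential_of_mem_U {x : P} (hx : x ∈ M.U) :
    M.potential rk h N x = (2 * rk (M.minv x) + 1) * N + 2 * h (M.minv x) :=
  (if_neg fun hD => Set.disjoint_left.mp M.disj hD hx).trans (if_pos hx)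

theorem potential_of_notMem {x : P} (hD : x ∉ M.D) (hU : x ∉ M.U) :
    M.potential rk h N x = 2 * rk x * N :=
  (if_neg hD).trans (if_neg hU)

theorem potential_m_lt {d : P} (hd : d ∈ M.D) :
    M.potential rk h N (M.m d) < M.potential rk h N d := by
  rw [potential_of_mem_D hd, potential_of_mem_U (M.m_mem d hd), M.left_inv d hd]
  omega

theorem potential_lt_of_covBy (hrk : ∀ a b : P, a ⋖ b → rk b = rk a + 1)
    (hN : ∀ x, 2 * h x + 1 < N) (hh : ∀ a b, M.FormanStep a b → h a < h b)
    {x y : P} (hxy : x ⋖ y) (hne : ¬(x ∈ M.D ∧ y = M.m x)) :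
    M.potential rk h N x < M.potential rk h N y := by
  have hr := hrk x y hxy
  have rk_U : ∀ u ∈ M.U, rk u = rk (M.minv u) + 1 := fun u hu =>
    hrk _ _ (by simpa only [M.right_inv u hu] using M.cov _ (M.minv_mem u hu))
  have upper : M.potential rk h N x < (2 * rk x + 2) * N := by
    by_cases hxD : x ∈ M.D
    · rw [potential_of_mem_D hxD]
      nlinarith [hN x]
    · by_cases hxU : x ∈ M.U
      · rw [potential_of_mem_U hxU, rk_U x hxU]
        nlinarith [hN (M.minv x)]
      · rw [potential_of_notMem hxD hxU]
        nlinarith [hN x]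
  by_cases hyD : y ∈ M.D
  · rw [potential_of_mem_D hyD, hr]
    nlinarith
  by_cases hyU : y ∈ M.U
  · have hry := rk_U y hyU
    have hrx : rk (M.minv y) = rk x := by omega
    rw [potential_of_mem_U hyU, hrx]
    by_cases hxD : x ∈ M.D
    · have hxne : x ≠ M.minv y := by
        rintro rfl
        exact hne ⟨hxD, (M.right_inv y hyU).symm⟩
      have := hh x (M.minv y)
        ⟨hxD, M.minv_mem y hyU, by rwa [M.right_inv y hyU], hxne⟩
      rw [potential_of_mem_D hxD]
      omega
    by_cases hxU : x ∈ M.U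
    · rw [potential_of_mem_U hxU, rk_U x hxU]
      nlinarith [hN (M.minv x)]
    · rw [potential_of_notMem hxD hxU]
      nlinarith [hN x]
  · rw [potential_of_notMem hyD hyU, hr]
    nlinarith

end PartialMatching

/-- existence of an injective `f : P → ℤ` with
`f e ≥ f e' ↔ (e ∈ D ∧ e' = μ e)` for every covering pair `e ⋖ e'`. -/
theorem stmt1 {P : Type} [PartialOrder P] [Fintype P]
    (rk : P → ℕ) (hrk : ∀ a b : P, a ⋖ b → rk b = rk a + 1)
    (M : PartialMatching P) (hM : M.IsAcyclic) :
    ∃ f : P → ℤ, Function.Injective f ∧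
      ∀ e e' : P, e ⋖ e' → (f e' ≤ f e ↔ e ∈ M.D ∧ e' = M.m e) := by
  obtain ⟨h, hcard, hh⟩ := exists_height_of_transGen_irrefl hM.transGen_formanStep_irrefl
  obtain ⟨f, hinj, hf⟩ :=
    exists_injective_int_refinement (M.potential rk h (2 * Fintype.card P + 2))
  refine ⟨f, hinj, fun e e' hcov => ⟨fun hle => ?_, ?_⟩⟩
  · by_contra hne
    exact (hf e e' (PartialMatching.potential_lt_of_covBy hrk
      (fun x => by have := hcard x; omega) hh hcov hne)).not_ge hle
  · rintro ⟨hD, rfl⟩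
    exact (hf _ _ (PartialMatching.potential_m_lt hD)).le
end

section
/- Let μ be an acyclic partial matching on a finite graded poset P and γ, γ' flow paths with γ ⪯ γ'. Then the embedding function witnessing γ ⪯ γ' is unique: if φ : {0, …, k} → {0, …, ℓ(γ')+1} and φ' : {0, …, k'} → {0, …, ℓ(γ')+1} are both embedding functions for γ ⪯ γ', then k = k' and φ = φ'. -/
/-- A rank function on a finite poset is strictly monotone. -/
lemma strictMono_of_covBy_rank {P : Type} [PartialOrder P] [Finite P]
    {rk : P → ℕ} (hrk : ∀ a b : P, a ⋖ b → rk b = rk a + 1) : StrictMono rk := by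
  classical
  have := Fintype.ofFinite P
  let _ : LocallyFiniteOrder P := Fintype.toLocallyFiniteOrder
  exact (strictMono_iff_forall_covBy rk).2 fun a b hab => by
    rw [hrk a b hab]; exact Nat.lt_succ_self _

namespace PartialMatching

variable {P : Type} [PartialOrder P]

lemma minv_covBy (M : PartialMatching P) {u : P} (hu : u ∈ M.U) : M.minv u ⋖ u := by
  simpa only [M.right_inv u hu] using M.cov _ (M.minv_mem u hu)

end PartialMatching

namespace FlowPath

variable {P : Type} [PartialOrder P] {M : PartialMatching P} {γ γ' : FlowPath P}

/-- One step of a flow path either lowers the rank of the upper cell or is a Forman step. -/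
lemma Valid.rank_step [Finite P] {rk : P → ℕ} (hrk : ∀ a b : P, a ⋖ b → rk b = rk a + 1)
    (hγ : γ.Valid M) {i : ℕ} (hi : i + 1 < γ.len) :
    rk (γ.uAt (i + 1)) < rk (γ.uAt i) ∨
      rk (γ.uAt (i + 1)) = rk (γ.uAt i) ∧ M.minv (γ.uAt (i + 1)) ⋖ γ.uAt i ∧
        M.minv (γ.uAt (i + 1)) ≠ M.minv (γ.uAt i) := by
  have hmono := strictMono_of_covBy_rank hrk
  obtain ⟨-, -, hlt, hne⟩ := hγ.2 i (by omega)
  obtain ⟨hu, he, -, -⟩ := hγ.2 (i + 1) hi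
  rcases he with he | he <;> rw [he] at hlt hne
  · exact Or.inl (hmono hlt)
  · have hr := hrk _ _ (M.minv_covBy hu)
    have hl := hmono hlt
    by_cases heq : rk (γ.uAt (i + 1)) = rk (γ.uAt i)
    · refine Or.inr ⟨heq, ⟨hlt, fun c hc hc' => ?_⟩, hne⟩
      have := hmono hc
      have := hmono hc'
      omega
    · left; omega

lemma Valid.rank_uAt_le [Finite P] {rk : P → ℕ} (hrk : ∀ a b : P, a ⋖ b → rk b = rk a + 1)
    (hγ : γ.Valid M) (i n : ℕ) (hi : i + n < γ.len) :
    rk (γ.uAt (i + n)) ≤ rk (γ.uAt i) := by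
  induction n with
  | zero => exact le_rfl
  | succ n ih =>
    have := ih (by omega)
    rcases hγ.rank_step hrk (i := i + n) hi with h | h <;> simp only [← add_assoc] <;> omega

/-- The upper cells of a flow path of an acyclic matching are pairwise distinct. -/
lemma Valid.uAt_ne [Finite P] {rk : P → ℕ} (hrk : ∀ a b : P, a ⋖ b → rk b = rk a + 1)
    (hM : M.IsAcyclic) (hγ : γ.Valid M) (n a : ℕ) (hn : 0 < n) (ha : a + n < γ.len) :
    γ.uAt a ≠ γ.uAt (a + n) := by
  induction n using Nat.strong_induction_on generalizing a with
  | _ n ih =>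
    intro heq
    have hstep : ∀ i < n, M.minv (γ.uAt (a + i + 1)) ⋖ γ.uAt (a + i) ∧
        M.minv (γ.uAt (a + i + 1)) ≠ M.minv (γ.uAt (a + i)) := by
      intro i hi
      rcases hγ.rank_step hrk (i := a + i) (by omega) with h | h
      · have h₁ := hγ.rank_uAt_le hrk a i (by omega)
        have h₂ := hγ.rank_uAt_le hrk (a + i + 1) (n - i - 1) (by omega)
        rw [show a + i + 1 + (n - i - 1) = a + n by omega, ← heq] at h₂
        omega
      · exact h.2
    have hU : ∀ i < n, γ.uAt (a + i) ∈ M.U := fun i hi => (hγ.2 (a + i) (by omega)).1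
    have hinj : ∀ i j, i < j → j < n → M.minv (γ.uAt (a + i)) ≠ M.minv (γ.uAt (a + j)) := by
      intro i j hij hj h
      have h' := congrArg M.m h
      rw [M.right_inv _ (hU i (by omega)), M.right_inv _ (hU j hj)] at h'
      refine ih (j - i) (by omega) (a + i) (by omega) (by omega) ?_
      rwa [show a + i + (j - i) = a + j by omega]
    have hlast := hstep (n - 1) (by omega)
    rw [show a + (n - 1) + 1 = a + n by omega, ← heq] at hlast
    rcases hM n (fun i => M.minv (γ.uAt (a + i))) hn
      (fun i j hi hj h => by
        rcases lt_trichotomy i j with hij | hij | hij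
        · exact absurd h (hinj i j hij hj)
        · exact hij
        · exact absurd h.symm (hinj j i hij hi))
      (fun i hi => M.minv_mem _ (hU i hi))
      (fun i hi => by
        simpa only [M.right_inv _ (hU i (by omega)), add_assoc] using (hstep i (by omega)).1)
      with h | h
    · subst h
      exact hlast.2 rfl
    · refine h ?_
      simpa only [M.right_inv _ (hU (n - 1) (by omega)), add_zero] using hlast.1

lemma Valid.uAt_inj [Finite P] {rk : P → ℕ} (hrk : ∀ a b : P, a ⋖ b → rk b = rk a + 1)
    (hM : M.IsAcyclic) (hγ : γ.Valid M) {i j : ℕ} (hi : i < γ.len) (hj : j < γ.len)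
    (h : γ.uAt i = γ.uAt j) : i = j := by
  rcases lt_trichotomy i j with hij | hij | hij
  · refine absurd h ?_
    simpa only [Nat.add_sub_cancel' hij.le] using
      hγ.uAt_ne hrk hM (j - i) i (by omega) (by omega)
  · exact hij
  · refine absurd h.symm ?_
    simpa only [Nat.add_sub_cancel' hij.le] using
      hγ.uAt_ne hrk hM (i - j) j (by omega) (by omega)

/-- Interior values of an embedding function are 1-based indices of steps. -/
lemma IsEmbed.bounds {k : ℕ} {φ : ℕ → ℕ} (h : γ.IsEmbed γ' k φ) {j : ℕ} (hj : 1 ≤ j)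
    (hjk : j < k) : 1 ≤ φ j ∧ φ j ≤ γ'.len := by
  obtain ⟨-, -, hmono, h0, hk, -, -⟩ := h
  have := hmono 0 j (by omega) hjk.le
  have := hmono j k hjk le_rfl
  omega

lemma IsEmbed.eq_of_lt [Finite P] {rk : P → ℕ} (hrk : ∀ a b : P, a ⋖ b → rk b = rk a + 1)
    (hM : M.IsAcyclic) (hγ' : γ'.Valid M) {k k' : ℕ} {φ φ' : ℕ → ℕ}
    (h : γ.IsEmbed γ' k φ) (h' : γ.IsEmbed γ' k' φ') {j : ℕ} (hj : j < k) (hj' : j < k') :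
    φ j = φ' j := by
  rcases Nat.eq_zero_or_pos j with rfl | hpos
  · rw [h.2.2.2.1, h'.2.2.2.1]
  · have hb := h.bounds hpos hj
    have hb' := h'.bounds hpos hj'
    have := hγ'.uAt_inj hrk hM (i := φ j - 1) (j := φ' j - 1) (by omega) (by omega)
      ((h.2.2.2.2.2.1 j hpos hj).symm.trans (h'.2.2.2.2.2.1 j hpos hj'))
    omega

lemma IsEmbed.le [Finite P] {rk : P → ℕ} (hrk : ∀ a b : P, a ⋖ b → rk b = rk a + 1)
    (hM : M.IsAcyclic) (hγ : γ.Valid M) (hγ' : γ'.Valid M) {k k' : ℕ} {φ φ' : ℕ → ℕ}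
    (h : γ.IsEmbed γ' k φ) (h' : γ.IsEmbed γ' k' φ') : k' ≤ k := by
  by_contra! hlt
  have hprev := h.eq_of_lt hrk hM hγ' h' (j := k - 1) (by have := h.1; omega) (by omega)
  obtain ⟨hk1, -, -, -, hk, -, hle⟩ := h
  have hb := h'.bounds hk1 hlt
  obtain ⟨-, hk', hmono', -, -, hu', -⟩ := h'
  have hmk := hmono' (k - 1) k (by omega) hlt.le
  have he := hle k (φ' k + 1) hk1 le_rfl (by omega) (by omega)
  obtain ⟨hU, hor, -, -⟩ := hγ.2 (k - 1) (by omega)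
  obtain ⟨-, -, hlt', hne'⟩ := hγ'.2 (φ' k - 1) (by omega)
  rw [← hu' k hk1 hlt, show φ' k - 1 + 1 = φ' k by omega] at hlt' hne'
  rw [Nat.add_sub_cancel] at he
  rcases hor with hor | hor <;> rw [hor] at he
  · exact absurd hlt' he.not_gt
  · exact (M.minv_covBy hU).2 (lt_of_le_of_ne he hne'.symm) hlt'

end FlowPath

/-- uniqueness of embedding functions. -/
theorem stmt5 {P : Type} [PartialOrder P] [Fintype P]
    (rk : P → ℕ) (hrk : ∀ a b : P, a ⋖ b → rk b = rk a + 1)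
    (M : PartialMatching P) (hM : M.IsAcyclic)
    (γ γ' : FlowPath P) (hγ : γ.Valid M) (hγ' : γ'.Valid M)
    (k k' : ℕ) (φ φ' : ℕ → ℕ)
    (h : γ.IsEmbed γ' k φ) (h' : γ.IsEmbed γ' k' φ') :
    k = k' ∧ ∀ j ≤ k, φ j = φ' j := by
  have hkk : k = k' := le_antisymm
    (h'.le hrk hM hγ hγ' h) (h.le hrk hM hγ hγ' h')
  subst hkk
  refine ⟨rfl, fun j hj => ?_⟩
  rcases hj.lt_or_eq with hj | rfl
  · exact h.eq_of_lt hrk hM hγ' h' hj hj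
  · rw [h.2.2.2.2.1, h'.2.2.2.2.1]
end

section
/- Let μ be an acyclic partial matching on a finite graded poset P and γ, γ' flow paths with γ ⪯ γ' and τ(γ) = τ(γ'). Then the (unique) embedding function for γ ⪯ γ' is defined on {0, 1, …, ℓ(γ)+1}, i.e., its domain parameter satisfies k = ℓ(γ)+1. If moreover ℓ(γ) = ℓ(γ'), then the embedding function is the identity map of {0, 1, …, ℓ(γ)+1}. -/
/-- A function to `ℕ` increasing by one along covers of a finite poset is strictly monotone. -/
theorem strictMono_of_covBy_succ {P : Type} [PartialOrder P] [Fintype P] (rk : P → ℕ)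
    (hrk : ∀ a b : P, a ⋖ b → rk b = rk a + 1) : StrictMono rk := by
  classical
  let _ : LocallyFiniteOrder P := Fintype.toLocallyFiniteOrder
  intro a b hab
  induction transGen_covBy_of_lt hab with
  | single hc => have := hrk _ _ hc; omega
  | tail hac hc ih => have := hrk _ _ hc; have := ih (lt_iff_transGen_covBy.mpr hac); omega

theorem FlowPath.eAt_len {P : Type} (γ : FlowPath P) : γ.eAt γ.len = γ.c := by
  simp [eAt, len]

namespace FlowPath

variable {P : Type} [PartialOrder P]

namespace Valid

variable {M : PartialMatching P} {γ : FlowPath P} {rk : P → ℕ}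

theorem rk_eAt_succ_le (hγ : γ.Valid M) (hmono : StrictMono rk)
    (hrk : ∀ a b : P, a ⋖ b → rk b = rk a + 1) {i : ℕ} (hi : i < γ.len) :
    rk (γ.eAt (i + 1)) ≤ rk (γ.eAt i) := by
  obtain ⟨hu, he, hlt, -⟩ := hγ.2 i hi
  have hcov := hrk _ _ (M.cov _ (M.minv_mem _ hu))
  rw [M.right_inv _ hu] at hcov
  have := hmono hlt
  rcases he with he | he <;> rw [he] <;> omega

theorem rk_c_le (hγ : γ.Valid M) (hmono : StrictMono rk)
    (hrk : ∀ a b : P, a ⋖ b → rk b = rk a + 1) {i : ℕ} (hi : i ≤ γ.len) :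
    rk γ.c ≤ rk (γ.eAt i) := by
  induction hi using Nat.decreasingInduction with
  | self => rw [eAt_len]
  | of_succ i hi ih => exact ih.trans (hγ.rk_eAt_succ_le hmono hrk hi)

theorem eAt_ne_c (hγ : γ.Valid M) {i : ℕ} (hi : i < γ.len) : γ.eAt i ≠ γ.c := by
  obtain ⟨hu, he, -⟩ := hγ.2 i hi
  intro h
  apply hγ.1
  rcases he with he | he
  · exact Or.inr (h ▸ he ▸ hu)
  · exact Or.inl (h ▸ he ▸ M.minv_mem _ hu)

end Valid

end FlowPath

/-- A strictly increasing endomap of `{0, …, k}` fixing `k` is the identity. -/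
theorem eq_self_of_strictMono_le {k : ℕ} {φ : ℕ → ℕ} (hφ : ∀ i j, i < j → j ≤ k → φ i < φ j)
    (hk : φ k = k) {j : ℕ} (hj : j ≤ k) : φ j = j := by
  have hle : j ≤ φ j := by
    clear hk
    induction j with
    | zero => omega
    | succ j ih =>
      have := hφ j (j + 1) j.lt_succ_self hj
      have := ih (by omega)
      omega
  have hge : φ j ≤ j := by
    clear hle
    induction hj using Nat.decreasingInduction with
    | self => omega
    | of_succ i hi ih =>
      have := hφ i (i + 1) i.lt_succ_self hi
      omega
  omega

/-- if `γ ⪯ γ'` and `τ(γ) = τ(γ')`, the embedding function is defined on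
`{0,…,ℓ(γ)+1}` (i.e. `k = ℓ(γ)+1`); and if moreover `ℓ(γ) = ℓ(γ')` it is the identity. -/
theorem stmt8 {P : Type} [PartialOrder P] [Fintype P]
    (rk : P → ℕ) (hrk : ∀ a b : P, a ⋖ b → rk b = rk a + 1)
    (M : PartialMatching P) (hM : M.IsAcyclic)
    (γ γ' : FlowPath P) (hγ : γ.Valid M) (hγ' : γ'.Valid M)
    (htgt : γ.tgt = γ'.tgt)
    (k : ℕ) (φ : ℕ → ℕ) (h : γ.IsEmbed γ' k φ) :
    k = γ.len + 1 ∧ (γ.len = γ'.len → ∀ j ≤ k, φ j = j) := by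
  obtain ⟨hk1, hk, hφ, -, hφk, -, hle⟩ := h
  have hmono := strictMono_of_covBy_succ rk hrk
  have hkey : k = γ.len + 1 := by
    by_contra hne
    have hlt := hφ (k - 1) k (by omega) le_rfl
    have he := hle k (φ k) hk1 le_rfl hlt le_rfl
    rw [hφk, Nat.add_sub_cancel, FlowPath.eAt_len, ← show γ.c = γ'.c from htgt] at he
    have := hmono (lt_of_le_of_ne he (hγ.eAt_ne_c (by omega)))
    have := hγ.rk_c_le hmono hrk (i := k - 1) (by omega)
    omega
  refine ⟨hkey, fun hlen j hj => eq_self_of_strictMono_le hφ ?_ hj⟩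
  omega
end

section
/- Let μ be an acyclic partial matching on a finite graded poset P. For every flow path γ ∈ FP(μ), the set {δ ∈ FP̄(μ) : δ ⪯ γ} of reduced flow paths below γ is nonempty and has a greatest element r(γ) with respect to ⪯. Moreover τ(r(γ)) = τ(γ), r(γ) = γ whenever γ is reduced, and the map γ ↦ r(γ) is monotone (γ ⪯ γ' implies r(γ) ⪯ r(γ')) and satisfies r(γ) ⪯ γ and r(r(γ)) = r(γ); that is, r is a descending closure operator on (FP(μ), ⪯) whose image is FP̄(μ). -/
namespace FlowPath

section Erase

variable {P : Type}

/-- The flow path obtained by deleting the `i`-th step (0-based). -/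
def erase (γ : FlowPath P) (i : ℕ) : FlowPath P := ⟨γ.steps.eraseIdx i, γ.c⟩

theorem len_erase {γ : FlowPath P} {i : ℕ} (hi : i < γ.len) :
    (γ.erase i).len + 1 = γ.len := by
  simp only [len, erase, List.length_eraseIdx] at *
  split <;> omega

theorem eAt_erase (γ : FlowPath P) (i j : ℕ) :
    (γ.erase i).eAt j = if j < i then γ.eAt j else γ.eAt (j + 1) := by
  simp only [eAt, erase, List.getD_eq_getElem?_getD, List.getElem?_map, List.getElem?_eraseIdx]
  split <;> rfl

theorem uAt_erase (γ : FlowPath P) (i j : ℕ) :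
    (γ.erase i).uAt j = if j < i then γ.uAt j else γ.uAt (j + 1) := by
  simp only [uAt, erase, List.getD_eq_getElem?_getD, List.getElem?_map, List.getElem?_eraseIdx]
  split <;> rfl

end Erase

section Subpath

variable {P : Type} [PartialOrder P]

theorem Subpath.refl (γ : FlowPath P) : γ.Subpath γ := by
  refine ⟨γ.len + 1, id, by omega, le_rfl, fun i j h _ => h, rfl, rfl, fun _ _ _ => rfl, ?_⟩
  intro j p _ _ h₁ h₂
  simp only [id] at h₁ h₂
  obtain rfl : p = j := by omega
  exact le_rfl

theorem Subpath.trans {γ γ' γ'' : FlowPath P} (h : γ.Subpath γ') (h' : γ'.Subpath γ'') :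
    γ.Subpath γ'' := by
  classical
  obtain ⟨k, φ, _, hkl, hmono, h0, hlast, hu, he⟩ := h
  obtain ⟨k', ψ, hk', hkl', hmono', h0', hlast', hu', he'⟩ := h'
  have hex : ∃ j, k' ≤ φ j := ⟨k, by omega⟩
  obtain ⟨t, ht, hmin⟩ : ∃ t, k' ≤ φ t ∧ ∀ j < t, φ j < k' :=
    ⟨Nat.find hex, Nat.find_spec hex, fun j hj => not_le.1 (Nat.find_min hex hj)⟩
  have htk : t ≤ k := by
    by_contra hlt
    have := hmin k (by omega)
    omega
  have ht1 : 1 ≤ t := by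
    by_contra hlt
    obtain rfl : t = 0 := by omega
    omega
  refine ⟨t, fun j => ψ (min (φ j) k'), ht1, by omega, ?_, ?_, ?_, ?_, ?_⟩
  · intro i j hij hjt
    have h₁ := hmono i j hij (by omega)
    have h₂ := hmin i (by omega)
    exact hmono' _ _ (by omega) (by omega)
  · simp [h0, h0']
  · simp [ht, hlast']
  · intro j hj hjt
    have h₁ := hmin j hjt
    have h₂ := hmono 0 j (by omega) (by omega)
    dsimp only
    rw [hu j hj (by omega), hu' (φ j) (by omega) h₁, min_eq_left h₁.le]
  · intro j q hj hjt h₁ h₂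
    dsimp only at h₁ h₂
    have hex' : ∃ p, q ≤ ψ p := ⟨_, h₂⟩
    obtain ⟨p, hp, hpmin⟩ : ∃ p, q ≤ ψ p ∧ ∀ l < p, ψ l < q :=
      ⟨Nat.find hex', Nat.find_spec hex', fun l hl => not_le.1 (Nat.find_min hex' hl)⟩
    have hple : p ≤ min (φ j) k' := by
      by_contra hlt
      exact (hpmin _ (not_le.1 hlt)).not_ge h₂
    have hlt : φ (j - 1) < p := by
      by_contra hle
      have h₃ := hmin (j - 1) (by omega)
      rw [min_eq_left h₃.le] at h₁
      rcases (not_lt.1 hle).eq_or_lt with h₄ | h₄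
      · subst h₄
        omega
      · have := hmono' _ _ h₄ h₃.le
        omega
    exact (he j p hj (by omega) hlt (by omega)).trans
      (he' p q (by omega) (by omega) (hpmin _ (by omega)) hp)

variable {M : PartialMatching P} {γ : FlowPath P} {i : ℕ}

theorem minv_covBy {u : P} (hu : u ∈ M.U) : M.minv u ⋖ u := by
  simpa only [M.right_inv u hu] using M.cov _ (M.minv_mem u hu)

theorem ReducibleAt.eAt_succ_lt (h : γ.ReducibleAt M i) (hγ : γ.Valid M) :
    γ.eAt (i + 1) < γ.eAt i := by
  obtain ⟨hu, he, hlt, -⟩ := hγ.2 i h.1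
  rcases he with he | he
  · rwa [he]
  · rw [he]
    exact h.2

theorem minv_le_eAt (hγ : γ.Valid M) (hi : i < γ.len) : M.minv (γ.uAt i) ≤ γ.eAt i := by
  obtain ⟨hu, he, -, -⟩ := hγ.2 i hi
  rcases he with he | he
  · rw [he]
    exact (minv_covBy hu).le
  · exact he.ge

theorem ReducibleAt.valid_erase (h : γ.ReducibleAt M i) (hγ : γ.Valid M) :
    (γ.erase i).Valid M := by
  refine ⟨hγ.1, fun j hj => ?_⟩
  have hlen := len_erase h.1
  simp only [eAt_erase, uAt_erase]
  rcases lt_trichotomy (j + 1) i with hji | hji | hji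
  · simpa only [if_pos hji, if_pos (by omega : j < i)] using hγ.2 j (by omega)
  · subst hji
    obtain ⟨hu, he, hlt, -⟩ := hγ.2 j (by omega)
    simp only [lt_irrefl, Nat.lt_succ_self, if_true, if_false]
    refine ⟨hu, he, (h.eAt_succ_lt hγ).trans hlt, fun heq => ?_⟩
    exact (minv_covBy hu).2 (heq ▸ h.eAt_succ_lt hγ) hlt
  · simpa only [if_neg (by omega : ¬ j + 1 < i), if_neg (by omega : ¬ j < i)]
      using hγ.2 (j + 1) (by omega)

theorem ReducibleAt.erase_subpath (h : γ.ReducibleAt M i) (hγ : γ.Valid M) :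
    (γ.erase i).Subpath γ := by
  have hi := h.1
  have hlen := len_erase hi
  refine ⟨γ.len, fun j => if j ≤ i then j else j + 1, by omega, by omega, ?_, ?_, ?_, ?_, ?_⟩
  · intro a b hab _
    dsimp only
    split_ifs <;> omega
  · simp
  · simp [hi]
  · intro j hj _
    simp only [uAt_erase]
    split_ifs <;> first | omega | rfl | (congr 1; omega)
  · intro j p hj _ h₁ h₂
    dsimp only at h₁ h₂
    rw [eAt_erase]
    by_cases hji : j - 1 < i
    · rw [if_pos (by omega)] at h₁ h₂
      obtain rfl : p = j := by omega
      rw [if_pos hji]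
    · rw [if_neg (by omega)] at h₂
      rw [if_neg hji]
      rcases (by split_ifs at h₁ <;> omega : p = j + 1 ∨ p = j ∧ j = i + 1) with rfl | ⟨rfl, rfl⟩
      · rw [Nat.sub_add_cancel hj, Nat.add_sub_cancel]
      · exact (h.eAt_succ_lt hγ).le

theorem ReducibleAt.subpath_erase {δ : FlowPath P} (h : γ.ReducibleAt M i)
    (hδ : δ.Reduced M) (hδγ : δ.Subpath γ) : δ.Subpath (γ.erase i) := by
  obtain ⟨k, φ, hk, hkl, hmono, h0, hlast, hu, he⟩ := hδγ
  have hi := h.1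
  have hlen := len_erase hi
  have hne : ∀ j ≤ k, φ j ≠ i + 1 := by
    intro j hjk hj
    have hj1 : 1 ≤ j := by
      by_contra hlt
      obtain rfl : j = 0 := by omega
      omega
    have hjk' : j < k := by
      refine lt_of_le_of_ne hjk ?_
      rintro rfl
      omega
    refine hδ (j - 1) ⟨by omega, ?_⟩
    have h₁ := hmono j (j + 1) (by omega) hjk'
    have h₂ := he (j + 1) (i + 2) (by omega) hjk' (by simp [hj]) (by omega)
    have h₃ := hu j hj1 hjk'
    rw [hj, Nat.add_sub_cancel] at h₃
    rw [h₃, Nat.sub_add_cancel hj1]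
    exact lt_of_le_of_lt h₂ h.2
  refine ⟨k, fun j => if φ j ≤ i then φ j else φ j - 1, hk, hkl, ?_, ?_, ?_, ?_, ?_⟩
  · intro a b hab hbk
    have h₁ := hmono a b hab hbk
    have h₂ := hne a (by omega)
    have h₃ := hne b hbk
    dsimp only
    split_ifs <;> omega
  · simp [h0]
  · dsimp only
    split_ifs <;> omega
  · intro j hj hjk
    have h₁ := hmono 0 j (by omega) hjk.le
    have h₂ := hne j hjk.le
    rw [hu j hj hjk, uAt_erase]
    dsimp only
    split_ifs <;> first | omega | rfl | (congr 1; omega)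
  · intro j p hj hjk h₁ h₂
    have h₃ := hne j hjk
    have h₄ := hne (j - 1) (by omega)
    dsimp only at h₁ h₂
    rw [eAt_erase]
    by_cases hp : p - 1 < i
    · rw [if_pos hp]
      exact he j p hj hjk (by split_ifs at h₁ <;> omega) (by split_ifs at h₂ <;> omega)
    · rw [if_neg hp]
      have hp1 : 1 ≤ p := by omega
      have := he j (p + 1) hj hjk (by split_ifs at h₁ <;> omega) (by split_ifs at h₂ <;> omega)
      rwa [Nat.add_sub_cancel, ← Nat.sub_add_cancel hp1] at this

theorem exists_isReduction (γ : FlowPath P) (hγ : γ.Valid M) :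
    ∃ rγ : FlowPath P, IsReduction M γ rγ ∧ rγ.tgt = γ.tgt ∧ (γ.Reduced M → rγ = γ) := by
  by_cases hred : γ.Reduced M
  · exact ⟨γ, ⟨hγ, hred, .refl γ, fun _ _ _ h => h⟩, rfl, fun _ => rfl⟩
  · obtain ⟨i, hi⟩ : ∃ i, γ.ReducibleAt M i := by simpa [Reduced] using hred
    have hlen := len_erase hi.1
    obtain ⟨rγ, ⟨hv, hr, hs, hmax⟩, ht, -⟩ := exists_isReduction _ (hi.valid_erase hγ)
    exact ⟨rγ, ⟨hv, hr, hs.trans (hi.erase_subpath hγ),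
      fun δ hδ hδr hδγ => hmax δ hδ hδr (hi.subpath_erase hδr hδγ)⟩, ht, fun h => (hred h).elim⟩
termination_by γ.len
decreasing_by omega

end Subpath

end FlowPath

/-- every flow path `γ` has a reduction `r(γ)`: the greatest reduced flow
path `⪯ γ`; it satisfies `τ(r(γ)) = τ(γ)`, `r(γ) = γ` for reduced `γ`, `r(γ) ⪯ γ`, and
the assignment is monotone (hence `r` is a descending closure operator with image the
reduced flow paths). -/
theorem stmt10 {P : Type} [PartialOrder P] [Fintype P]
    (rk : P → ℕ) (hrk : ∀ a b : P, a ⋖ b → rk b = rk a + 1)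
    (M : PartialMatching P) (hM : M.IsAcyclic) :
    ∀ γ : FlowPath P, γ.Valid M →
      ∃ rγ : FlowPath P,
        FlowPath.IsReduction M γ rγ ∧
        rγ.tgt = γ.tgt ∧
        (γ.Reduced M → rγ = γ) ∧
        (∀ γ' rγ' : FlowPath P, γ'.Valid M → FlowPath.IsReduction M γ' rγ' →
          γ.Subpath γ' → rγ.Subpath rγ') := by
  intro γ hγ
  obtain ⟨rγ, hr, ht, hred⟩ := FlowPath.exists_isReduction γ hγ
  exact ⟨rγ, hr, ht, hred, fun γ' rγ' _ hr' h =>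
    hr'.2.2.2 rγ hr.1 hr.2.1 (hr.2.2.1.trans h)⟩
end

section
/- Let μ be an acyclic partial matching on a finite graded poset P and c₂ a critical element. Let γ, δ be flow paths with τ(γ) = τ(δ) = c₂ and γ ⪯ δ, and let γ', δ' be flow paths with τ(γ') = τ(δ'), ι(γ') < c₂, ι(δ') < c₂, and γ' ⪯ δ'. Then γ * γ' ⪯ δ * δ'. (Concatenation of flow paths is a poset map in both variables.) -/
namespace FlowPath

variable {P : Type}

theorem eAt_len_s12 (γ : FlowPath P) : γ.eAt γ.len = γ.c := by
  simp [eAt, len]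

theorem eAt_concat_left (γ δ : FlowPath P) {i : ℕ} (hi : i < γ.len) :
    (γ.concat δ).eAt i = γ.eAt i := by
  have hi' : i < γ.steps.length := hi
  simp [eAt, concat, List.getD, List.getElem?_append_left, hi']

theorem uAt_concat_left (γ δ : FlowPath P) {i : ℕ} (hi : i < γ.len) :
    (γ.concat δ).uAt i = γ.uAt i := by
  have hi' : i < γ.steps.length := hi
  simp [uAt, concat, List.getD, List.getElem?_append_left, hi']

theorem eAt_concat_right (γ δ : FlowPath P) (i : ℕ) :
    (γ.concat δ).eAt (γ.len + i) = δ.eAt i := by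
  simp [eAt, concat, len, List.getD, List.getElem?_append_right]

theorem uAt_concat_right (γ δ : FlowPath P) (i : ℕ) :
    (γ.concat δ).uAt (γ.len + i) = δ.uAt i := by
  simp [uAt, concat, len, List.getD, List.getElem?_append_right]

theorem len_concat (γ δ : FlowPath P) : (γ.concat δ).len = γ.len + δ.len := by
  simp [len, concat]

variable [PartialOrder P]

/-- Ranks are weakly decreasing along the cells of a flow path, down to the target. -/
theorem Valid.rk_tgt_le {M : PartialMatching P} {γ : FlowPath P} (hγ : γ.Valid M)
    {rk : P → ℕ} (hrk : ∀ a b : P, a ⋖ b → rk b = rk a + 1) (hmono : StrictMono rk)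
    {i : ℕ} (hi : i ≤ γ.len) : rk γ.tgt ≤ rk (γ.eAt i) := by
  induction hi using Nat.decreasingInduction with
  | self => rw [eAt_len_s12, tgt]
  | of_succ i hi ih =>
    obtain ⟨hU, he, hlt, -⟩ := hγ.2 i hi
    have hcov := M.cov _ (M.minv_mem _ hU)
    rw [M.right_inv _ hU] at hcov
    have h₁ := hrk _ _ hcov
    have h₂ := hmono hlt
    rcases he with he | he <;> rw [he] <;> omega

/-- No cell of a flow path before the target lies below the target. -/
theorem Valid.not_eAt_le_tgt {M : PartialMatching P} {γ : FlowPath P} (hγ : γ.Valid M)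
    {rk : P → ℕ} (hrk : ∀ a b : P, a ⋖ b → rk b = rk a + 1) (hmono : StrictMono rk)
    {i : ℕ} (hi : i < γ.len) : ¬ γ.eAt i ≤ γ.tgt := by
  intro hle
  obtain ⟨hU, he, -, -⟩ := hγ.2 i hi
  rcases hle.eq_or_lt with heq | hlt
  · apply hγ.1
    change γ.tgt ∈ _
    rw [← heq]
    rcases he with he | he <;> rw [he]
    · exact Or.inr hU
    · exact Or.inl (M.minv_mem _ hU)
  · exact absurd (hγ.rk_tgt_le hrk hmono hi.le) (hmono hlt).not_ge

theorem IsEmbed.eq_len_add_one {M : PartialMatching P} {γ δ : FlowPath P} {k : ℕ} {φ : ℕ → ℕ}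
    (h : IsEmbed γ δ k φ) (hγ : γ.Valid M) (ht : γ.tgt = δ.tgt)
    {rk : P → ℕ} (hrk : ∀ a b : P, a ⋖ b → rk b = rk a + 1) (hmono : StrictMono rk) :
    k = γ.len + 1 := by
  obtain ⟨hk1, hk, hφ, -, hφk, -, he⟩ := h
  by_contra hne
  have hlast := he k (φ k) hk1 le_rfl (hφ _ _ (by omega) le_rfl) le_rfl
  rw [hφk, Nat.add_sub_cancel, eAt_len_s12] at hlast
  exact hγ.not_eAt_le_tgt hrk hmono (i := k - 1) (by omega) (ht ▸ hlast)

/-- An embedding that uses every cell of `γ` can be prolonged by an embedding `γ' ⪯ δ'`. -/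
theorem IsEmbed.concat {γ δ γ' δ' : FlowPath P} {k : ℕ} {φ φ' : ℕ → ℕ}
    (h : IsEmbed γ δ (γ.len + 1) φ) (h' : IsEmbed γ' δ' k φ') (hι : γ'.init ≤ γ.tgt) :
    IsEmbed (γ.concat γ') (δ.concat δ') (γ.len + k)
      (fun j => if j ≤ γ.len then φ j else δ.len + φ' (j - γ.len)) := by
  obtain ⟨-, -, hφ, hφ0, hφk, hu, he⟩ := h
  obtain ⟨hk1', hk', hφ', hφ0', hφk', hu', he'⟩ := h'
  have hle : ∀ j, j ≤ γ.len → φ j ≤ δ.len := fun j hj => by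
    have := hφ j (γ.len + 1) (by omega) le_rfl
    omega
  have hpos : ∀ j, 1 ≤ j → j ≤ γ.len → 1 ≤ φ j := fun j h1 hj => by
    have := hφ 0 j h1 (by omega)
    omega
  have hpos' : ∀ j, 1 ≤ j → j ≤ k → 1 ≤ φ' j := fun j h1 hj => by
    have := hφ' 0 j h1 hj
    omega
  refine ⟨by omega, by rw [len_concat]; omega, ?_, by simp [hφ0], ?_, ?_, ?_⟩
  · intro i j hij hj
    dsimp only
    split_ifs with hi hj' hj'
    · exact hφ i j hij (by omega)
    · have := hle i hi
      have := hpos' (j - γ.len) (by omega) (by omega)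
      omega
    · omega
    · have := hφ' (i - γ.len) (j - γ.len) (by omega) (by omega)
      omega
  · dsimp only
    rw [len_concat, if_neg (by omega), Nat.add_sub_cancel_left, hφk', add_assoc]
  · intro j hj1 hj
    dsimp only
    split_ifs with hjm
    · have h1 := hle j hjm
      have h2 := hpos j hj1 hjm
      rw [uAt_concat_left _ _ (by omega), uAt_concat_left _ _ (by omega)]
      exact hu j hj1 (by omega)
    · obtain ⟨i, rfl⟩ : ∃ i, j = γ.len + i := ⟨j - γ.len, by omega⟩
      have := hpos' i (by omega) (by omega)
      rw [Nat.add_sub_cancel_left, Nat.add_sub_assoc (by omega), Nat.add_sub_assoc this,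
        uAt_concat_right, uAt_concat_right]
      exact hu' i (by omega) (by omega)
  · intro j p hj1 hj hpj hp
    dsimp only at hpj hp
    by_cases hjm : j ≤ γ.len
    · have := hle j hjm
      rw [if_pos (by omega)] at hpj
      rw [if_pos hjm] at hp
      rw [eAt_concat_left _ _ (by omega), eAt_concat_left _ _ (by omega)]
      exact he j p hj1 (by omega) hpj hp
    rw [if_neg hjm] at hp
    obtain ⟨i, rfl⟩ : ∃ i, j = γ.len + i := ⟨j - γ.len, by omega⟩
    rw [Nat.add_sub_cancel_left] at hp
    rw [Nat.add_sub_assoc (by omega), eAt_concat_right]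
    rcases le_or_gt p δ.len with hpn | hpn
    · obtain rfl : i = 1 := by
        by_contra
        rw [if_neg (by omega)] at hpj
        omega
      rw [Nat.add_sub_cancel, if_pos le_rfl] at hpj
      rw [eAt_concat_left _ _ (by omega)]
      have := he (γ.len + 1) p (by omega) le_rfl hpj (by omega)
      rw [Nat.add_sub_cancel, eAt_len_s12] at this
      exact hι.trans this
    · obtain ⟨q, rfl⟩ : ∃ q, p = δ.len + q := ⟨p - δ.len, by omega⟩
      rw [Nat.add_sub_assoc (by omega), eAt_concat_right]
      refine he' i q (by omega) (by omega) ?_ (by omega)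
      rcases eq_or_ne i 1 with rfl | hi
      · rw [Nat.sub_self, hφ0']
        omega
      · rw [if_neg (by omega), show γ.len + i - 1 - γ.len = i - 1 by omega] at hpj
        omega

end FlowPath

/-- concatenation of flow paths is a poset map in both variables. -/
theorem stmt12 {P : Type} [PartialOrder P] [Fintype P]
    (rk : P → ℕ) (hrk : ∀ a b : P, a ⋖ b → rk b = rk a + 1)
    (M : PartialMatching P) (hM : M.IsAcyclic)
    (c₂ : P) (hc₂ : c₂ ∈ M.Cr)
    (γ δ γ' δ' : FlowPath P)
    (hγ : γ.Valid M) (hδ : δ.Valid M) (hγ' : γ'.Valid M) (hδ' : δ'.Valid M)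
    (hγt : γ.tgt = c₂) (hδt : δ.tgt = c₂) (h₁ : γ.Subpath δ)
    (ht' : γ'.tgt = δ'.tgt) (hι₁ : γ'.init < c₂) (hι₂ : δ'.init < c₂)
    (h₂ : γ'.Subpath δ') :
    (γ.concat γ').Subpath (δ.concat δ') := by
  classical
  let _ : LocallyFiniteOrder P := Fintype.toLocallyFiniteOrder
  have hmono : StrictMono rk := (strictMono_iff_forall_covBy rk).2 fun a b hab => by
    rw [hrk a b hab]
    exact Nat.lt_succ_self _
  obtain ⟨k, φ, h⟩ := h₁
  obtain ⟨k', φ', h'⟩ := h₂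
  obtain rfl := h.eq_len_add_one hγ (hγt.trans hδt.symm) hrk hmono
  exact ⟨_, _, h.concat h' (hγt ▸ hι₁.le)⟩
end
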